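/- Let Ŝ and T̂ be joint probability distributions over Z × Y with Z, Y countable, with feature marginals Ŝ(z), T̂(z), label marginals Ŝ(y), T̂(y), and label conditionals Ŝ(y|z), T̂(y|z). Then the label conditional shift is lower bounded by E_{z∼T̂(z)}[D_JS(Ŝ(y|z)‖T̂(y|z))] + E_{z∼Ŝ(z)}[D_JS(Ŝ(y|z)‖T̂(y|z))] ≥ 2·(max(√(D_JS(T̂(y)‖Ŝ(y))) − √(D_JS(Ŝ(z)‖T̂(z))), 0))². In particular, over-matching the feature marginal divergence D_JS(Ŝ(z)‖T̂(z)) to zero while the label marginals differ forces a large label conditional shift. -/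

import Mathlib

open MeasureTheory Real
open scoped ENNReal

/-- Kullback–Leibler divergence (natural logarithm) of `Q` with respect to `P`:
`E_Q[log (dQ/dP)]`; meaningful when `Q ≪ P`. -/
noncomputable def KLdiv {Ω : Type*} [MeasurableSpace Ω] (Q P : Measure Ω) : ℝ :=
  ∫ ω, Real.log ((Q.rnDeriv P ω).toReal) ∂Q

/-- Jensen–Shannon divergence: with `M = (P + Q)/2`,
`D_JS(P‖Q) = (D_KL(P‖M) + D_KL(Q‖M))/2`. -/
noncomputable def JSdiv {Ω : Type*} [MeasurableSpace Ω] (P Q : Measure Ω) : ℝ :=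
  (KLdiv P ((2 : ℝ≥0∞)⁻¹ • P + (2 : ℝ≥0∞)⁻¹ • Q) +
    KLdiv Q ((2 : ℝ≥0∞)⁻¹ • P + (2 : ℝ≥0∞)⁻¹ • Q)) / 2

open ProbabilityTheory

/-- Pointwise integrand of (twice) the Jensen–Shannon divergence, as a function of two densities. -/
noncomputable def jsFun (p q : ℝ) : ℝ :=
  p * log (p / ((p + q) / 2)) + q * log (q / ((p + q) / 2))

lemma abs_mul_log_div_midpoint_le {p q : ℝ} (hp : 0 ≤ p) (hq : 0 ≤ q) :
    |p * log (p / ((p + q) / 2))| ≤ p + q := by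
  rcases hp.eq_or_lt with rfl | hp
  · simpa using hq
  have hm : 0 < (p + q) / 2 := by positivity
  have hx : 0 < p / ((p + q) / 2) := by positivity
  have hpx : p * (p / ((p + q) / 2))⁻¹ = (p + q) / 2 := by field_simp
  have hle : p / ((p + q) / 2) ≤ 2 := by
    rw [div_le_iff₀ hm]; linarith
  have h1 := mul_le_mul_of_nonneg_left (log_le_sub_one_of_pos hx) hp.le
  have h2 := mul_le_mul_of_nonneg_left (one_sub_inv_le_log_of_pos hx) hp.le
  rw [mul_sub, hpx] at h2
  have h3 := mul_le_mul_of_nonneg_left hle hp.le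
  rw [abs_le]
  constructor <;> linarith

lemma jsFun_eq {p q : ℝ} (hp : 0 ≤ p) (hq : 0 ≤ q) :
    jsFun p q = p * log p + q * log q - (p + q) * log ((p + q) / 2) := by
  rcases hp.eq_or_lt with rfl | hp <;> rcases hq.eq_or_lt with rfl | hq
  · simp [jsFun]
  · rw [jsFun, log_div hq.ne' (by positivity)]; ring
  · rw [jsFun, log_div hp.ne' (by positivity)]; ring
  · rw [jsFun, log_div hp.ne' (by positivity), log_div hq.ne' (by positivity)]; ring

lemma jsFun_comm (p q : ℝ) : jsFun p q = jsFun q p := by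
  rw [jsFun, jsFun, add_comm q p, add_comm]

lemma jsFun_nonneg {p q : ℝ} (hp : 0 ≤ p) (hq : 0 ≤ q) : 0 ≤ jsFun p q := by
  have key {x y : ℝ} (hx : 0 ≤ x) (hy : 0 ≤ y) :
      (x - y) / 2 ≤ x * log (x / ((x + y) / 2)) := by
    rcases hx.eq_or_lt with rfl | hx
    · simp; linarith
    have h := mul_le_mul_of_nonneg_left
      (one_sub_inv_le_log_of_pos (x := x / ((x + y) / 2)) (by positivity)) hx.le
    have hxy : x * (x / ((x + y) / 2))⁻¹ = (x + y) / 2 := by field_simp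
    rw [mul_sub, hxy] at h
    linarith
  have h1 := key hp hq
  have h2 := key hq hp
  rw [add_comm q p] at h2
  rw [jsFun]
  linarith

lemma lintegral_Ioi_exp_neg_mul {c : ℝ} (hc : 0 < c) :
    ∫⁻ t in Set.Ioi (0 : ℝ), ENNReal.ofReal (exp (-(t * c))) = ENNReal.ofReal c⁻¹ := by
  have hint := integrableOn_exp_mul_Ioi (neg_lt_zero.mpr hc) 0
  have hval := integral_exp_mul_Ioi (neg_lt_zero.mpr hc) 0
  have heq (t : ℝ) : exp (-(t * c)) = exp (-c * t) := by congr 1; ring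
  simp_rw [heq]
  rw [← ofReal_integral_eq_lintegral_ofReal hint (ae_of_all _ fun t ↦ (exp_pos _).le), hval]
  congr 1
  simp [neg_div, div_neg]

lemma integral_inv_add {a b s : ℝ} (ha : 0 < a) (hab : a ≤ b) (hs : 0 < s) :
    ∫ r in a..b, (s + r)⁻¹ = log (s + b) - log (s + a) := by
  have hb : 0 < b := ha.trans_le hab
  rw [intervalIntegral.integral_comp_add_left (fun x ↦ x⁻¹) s,
    integral_inv_of_pos (by positivity) (by positivity), log_div (by positivity) (by positivity)]

lemma integral_integral_inv_add {a b : ℝ} (ha : 0 < a) (hab : a ≤ b) :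
    ∫ s in a..b, ∫ r in a..b, (s + r)⁻¹ = jsFun (2 * a) (2 * b) := by
  have hb : 0 < b := ha.trans_le hab
  have hinner : ∀ s ∈ Set.uIcc a b, ∫ r in a..b, (s + r)⁻¹ = log (s + b) - log (s + a) := by
    intro s hs
    rw [Set.uIcc_of_le hab] at hs
    exact integral_inv_add ha hab (ha.trans_le hs.1)
  rw [intervalIntegral.integral_congr hinner, intervalIntegral.integral_sub]
  · rw [intervalIntegral.integral_comp_add_right (fun x ↦ log x),
      intervalIntegral.integral_comp_add_right (fun x ↦ log x), integral_log, integral_log,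
      jsFun_eq (by positivity) (by positivity)]
    have h : (2 * a + 2 * b) / 2 = a + b := by ring
    rw [h, ← two_mul, ← two_mul, add_comm b a]
    ring
  · refine (ContinuousOn.log (by fun_prop) fun s hs ↦ ?_).intervalIntegrable
    rw [Set.uIcc_of_le hab] at hs
    linarith [hs.1]
  · refine (ContinuousOn.log (by fun_prop) fun s hs ↦ ?_).intervalIntegrable
    rw [Set.uIcc_of_le hab] at hs
    linarith [hs.1]

lemma setLIntegral_Ioc_ofReal {a b : ℝ} (hab : a ≤ b) {f : ℝ → ℝ}
    (hf : ContinuousOn f (Set.Icc a b)) (h0 : ∀ x ∈ Set.Icc a b, 0 ≤ f x) :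
    ∫⁻ x in Set.Ioc a b, ENNReal.ofReal (f x) = ENNReal.ofReal (∫ x in a..b, f x) := by
  rw [intervalIntegral.integral_of_le hab, ofReal_integral_eq_lintegral_ofReal]
  · exact (hf.integrableOn_Icc).mono_set Set.Ioc_subset_Icc_self
  · exact (ae_restrict_iff' measurableSet_Ioc).mpr
      (ae_of_all _ fun x hx ↦ h0 x (Set.Ioc_subset_Icc_self hx))

/-- Embedding of the Jensen–Shannon kernel into `L²(0, ∞)`. -/
lemma lintegral_sq_setLIntegral_exp {a b : ℝ} (ha : 0 < a) (hb : 0 < b) :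
    ∫⁻ t in Set.Ioi (0 : ℝ), (∫⁻ s in Set.uIoc a b, ENNReal.ofReal (exp (-(t * s)))) ^ (2 : ℝ) =
      ENNReal.ofReal (jsFun (2 * a) (2 * b)) := by
  wlog hab : a ≤ b generalizing a b
  · rw [Set.uIoc_comm, jsFun_comm]
    exact this hb ha (le_of_not_ge hab)
  rw [Set.uIoc_of_le hab]
  have hsq (t : ℝ) : (∫⁻ s in Set.Ioc a b, ENNReal.ofReal (exp (-(t * s)))) ^ (2 : ℝ) =
      ∫⁻ s in Set.Ioc a b, ∫⁻ r in Set.Ioc a b, ENNReal.ofReal (exp (-(t * (s + r)))) := by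
    have hm : Measurable fun s : ℝ ↦ ENNReal.ofReal (exp (-(t * s))) := by fun_prop
    rw [ENNReal.rpow_two, sq, ← lintegral_mul_const _ hm]
    refine lintegral_congr fun s ↦ ?_
    rw [← lintegral_const_mul _ hm]
    refine lintegral_congr fun r ↦ ?_
    rw [← ENNReal.ofReal_mul (exp_pos _).le, ← exp_add]
    congr 2
    ring
  simp_rw [hsq]
  rw [lintegral_lintegral_swap (by fun_prop)]
  calc ∫⁻ s in Set.Ioc a b, ∫⁻ t in Set.Ioi (0 : ℝ), ∫⁻ r in Set.Ioc a b,
        ENNReal.ofReal (exp (-(t * (s + r))))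
      = ∫⁻ s in Set.Ioc a b, ENNReal.ofReal (∫ r in a..b, (s + r)⁻¹) := by
        refine setLIntegral_congr_fun measurableSet_Ioc fun s hs ↦ ?_
        have hs0 : 0 < s := ha.trans hs.1
        have hpos : ∀ r ∈ Set.Icc a b, 0 < s + r := fun r hr ↦ by linarith [hr.1]
        rw [lintegral_lintegral_swap (by fun_prop), ← setLIntegral_Ioc_ofReal (f := fun r ↦ (s + r)⁻¹) hab
          (ContinuousOn.inv₀ (by fun_prop) fun r hr ↦ (hpos r hr).ne')
          fun r hr ↦ (inv_pos.mpr (hpos r hr)).le]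
        exact setLIntegral_congr_fun measurableSet_Ioc fun r hr ↦
          lintegral_Ioi_exp_neg_mul (hpos r (Set.Ioc_subset_Icc_self hr))
    _ = ENNReal.ofReal (jsFun (2 * a) (2 * b)) := by
        rw [← integral_integral_inv_add ha hab]
        have hpos : ∀ s ∈ Set.Icc a b, ∀ r ∈ Set.Icc a b, 0 < s + r :=
          fun s hs r hr ↦ by linarith [hs.1, hr.1]
        refine setLIntegral_Ioc_ofReal hab ?_ fun s hs ↦ ?_
        · have hcont : ContinuousOn (fun s ↦ log (s + b) - log (s + a)) (Set.Icc a b) := by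
            refine ContinuousOn.sub (ContinuousOn.log (by fun_prop) fun s hs ↦ ?_)
              (ContinuousOn.log (by fun_prop) fun s hs ↦ ?_) <;> linarith [hs.1]
          exact hcont.congr fun s hs ↦ integral_inv_add ha hab (ha.trans_le hs.1)
        · exact intervalIntegral.integral_nonneg hab fun r hr ↦ (inv_pos.mpr (hpos s hs r hr)).le

lemma uIoc_subset_union {α : Type*} [LinearOrder α] (a b c : α) :
    Set.uIoc a b ⊆ Set.uIoc a c ∪ Set.uIoc c b := by
  intro x
  simp only [Set.mem_union, Set.mem_uIoc]
  grind

lemma sqrt_jsFun_triangle_of_pos {p q r : ℝ} (hp : 0 < p) (hq : 0 < q) (hr : 0 < r) :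
    √(jsFun p q) ≤ √(jsFun p r) + √(jsFun r q) := by
  let ψ (x y t : ℝ) : ℝ≥0∞ := ∫⁻ s in Set.uIoc (x / 2) (y / 2), ENNReal.ofReal (exp (-(t * s)))
  have hψ (x y : ℝ) : Measurable (ψ x y) := by
    refine Measurable.lintegral_prod_right' (f := fun z : ℝ × ℝ ↦
      ENNReal.ofReal (exp (-(z.1 * z.2)))) (by fun_prop)
  have hnorm {x y : ℝ} (hx : 0 < x) (hy : 0 < y) :
      (∫⁻ t in Set.Ioi (0 : ℝ), ψ x y t ^ (2 : ℝ)) ^ (1 / (2 : ℝ)) =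
        ENNReal.ofReal √(jsFun x y) := by
    rw [lintegral_sq_setLIntegral_exp (half_pos hx) (half_pos hy),
      mul_div_cancel₀ _ two_ne_zero, mul_div_cancel₀ _ two_ne_zero,
      ENNReal.ofReal_rpow_of_nonneg (jsFun_nonneg hx.le hy.le) (by norm_num), sqrt_eq_rpow]
  have hle : ∀ t, ψ p q t ≤ (ψ p r + ψ r q) t := fun t ↦
    (lintegral_mono_set (uIoc_subset_union _ _ _)).trans (lintegral_union_le _ _ _)
  rw [← ENNReal.ofReal_le_ofReal_iff (by positivity),
    ENNReal.ofReal_add (sqrt_nonneg _) (sqrt_nonneg _), ← hnorm hp hq, ← hnorm hp hr, ← hnorm hr hq]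
  refine le_trans ?_ (ENNReal.lintegral_Lp_add_le (hψ p r).aemeasurable (hψ r q).aemeasurable
    one_le_two)
  gcongr with t
  exact hle t

lemma sqrt_jsFun_triangle {p q r : ℝ} (hp : 0 ≤ p) (hq : 0 ≤ q) (hr : 0 ≤ r) :
    √(jsFun p q) ≤ √(jsFun p r) + √(jsFun r q) := by
  have hlim {x y : ℝ} (hx : 0 ≤ x) (hy : 0 ≤ y) :
      Filter.Tendsto (fun ε : ℝ ↦ √(jsFun (x + ε) (y + ε))) (nhdsWithin 0 (Set.Ioi 0))
        (nhds √(jsFun x y)) := by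
    have hcont : Continuous fun ε : ℝ ↦ √((x + ε) * log (x + ε) + (y + ε) * log (y + ε) -
        2 * ((x + ε + (y + ε)) / 2 * log ((x + ε + (y + ε)) / 2))) := by
      have hc := continuous_mul_log
      exact Real.continuous_sqrt.comp (((hc.comp (continuous_const.add continuous_id)).add
        (hc.comp (continuous_const.add continuous_id))).sub (continuous_const.mul
          (hc.comp (by fun_prop : Continuous fun ε : ℝ ↦ (x + ε + (y + ε)) / 2))))
    have h0 := (hcont.tendsto 0).mono_left (nhdsWithin_le_nhds (s := Set.Ioi 0))
    have heq {ε : ℝ} (hε : 0 ≤ ε) : √((x + ε) * log (x + ε) + (y + ε) * log (y + ε) -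
        2 * ((x + ε + (y + ε)) / 2 * log ((x + ε + (y + ε)) / 2))) =
        √(jsFun (x + ε) (y + ε)) := by
      rw [jsFun_eq (by positivity) (by positivity)]
      congr 1
      ring
    rw [heq le_rfl, add_zero, add_zero] at h0
    refine h0.congr' ?_
    filter_upwards [self_mem_nhdsWithin] with ε hε using heq (le_of_lt hε)
  refine le_of_tendsto_of_tendsto (hlim hp hq) ((hlim hp hr).add (hlim hr hq)) ?_
  filter_upwards [self_mem_nhdsWithin] with ε (hε : 0 < ε)
  exact sqrt_jsFun_triangle_of_pos (by positivity) (by positivity) (by positivity)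

section Measure

variable {Ω : Type*} [MeasurableSpace Ω]

lemma sqrt_integral_le_add {ν : Measure Ω} {f g h : Ω → ℝ} (hf : Integrable f ν)
    (hg : Integrable g ν) (hh : Integrable h ν) (hf0 : ∀ x, 0 ≤ f x) (hg0 : ∀ x, 0 ≤ g x)
    (hh0 : ∀ x, 0 ≤ h x) (hle : ∀ x, √(f x) ≤ √(g x) + √(h x)) :
    √(∫ x, f x ∂ν) ≤ √(∫ x, g x ∂ν) + √(∫ x, h x ∂ν) := by
  have hmem {u : Ω → ℝ} (hu : Integrable u ν) (hu0 : ∀ x, 0 ≤ u x) :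
      MemLp (fun x ↦ √(u x)) 2 ν := by
    rw [memLp_two_iff_integrable_sq (Real.continuous_sqrt.comp_aestronglyMeasurable hu.1)]
    exact hu.congr (ae_of_all _ fun x ↦ (sq_sqrt (hu0 x)).symm)
  have hprod : Integrable (fun x ↦ √(g x) * √(h x)) ν :=
    (hmem hg hg0).integrable_mul (hmem hh hh0)
  have hcs : ∫ x, √(g x) * √(h x) ∂ν ≤ √(∫ x, g x ∂ν) * √(∫ x, h x ∂ν) := by
    have := integral_mul_le_Lp_mul_Lq_of_nonneg Real.HolderConjugate.two_two (μ := ν)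
      (f := fun x ↦ √(g x)) (g := fun x ↦ √(h x)) (ae_of_all _ fun x ↦ sqrt_nonneg _)
      (ae_of_all _ fun x ↦ sqrt_nonneg _) (by simpa using hmem hg hg0) (by simpa using hmem hh hh0)
    simpa [sq_sqrt, hg0, hh0, sqrt_eq_rpow (∫ x, _ ∂ν)] using this
  refine sqrt_le_iff.mpr ⟨by positivity, ?_⟩
  calc ∫ x, f x ∂ν ≤ ∫ x, (g x + h x + 2 * (√(g x) * √(h x))) ∂ν := by
        refine integral_mono hf ((hg.add hh).add (hprod.const_mul 2)) fun x ↦ ?_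
        have := pow_le_pow_left₀ (sqrt_nonneg _) (hle x) 2
        rw [add_sq, sq_sqrt (hf0 x), sq_sqrt (hg0 x), sq_sqrt (hh0 x)] at this
        linarith
    _ = ∫ x, g x ∂ν + ∫ x, h x ∂ν + 2 * ∫ x, √(g x) * √(h x) ∂ν := by
        rw [integral_add (f := fun x ↦ g x + h x) (hg.add hh) (hprod.const_mul 2), integral_add hg hh, integral_const_mul]
    _ ≤ (√(∫ x, g x ∂ν) + √(∫ x, h x ∂ν)) ^ 2 := by
        rw [add_sq, sq_sqrt (integral_nonneg hg0), sq_sqrt (integral_nonneg hh0)]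
        linarith

lemma JSdiv_comm (P Q : Measure Ω) : JSdiv P Q = JSdiv Q P := by
  rw [JSdiv, JSdiv, add_comm (_ • P), add_comm (KLdiv P _)]

lemma absolutelyContinuous_mixture_left (P Q : Measure Ω) :
    P ≪ (2 : ℝ≥0∞)⁻¹ • P + (2 : ℝ≥0∞)⁻¹ • Q :=
  (Measure.AbsolutelyContinuous.rfl.smul_right (by simp)).add_right _

lemma isFiniteMeasure_half_smul (P : Measure Ω) [IsFiniteMeasure P] :
    IsFiniteMeasure ((2 : ℝ≥0∞)⁻¹ • P) :=
  P.smul_finite (by simp)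

lemma isProbabilityMeasure_mixture (P Q : Measure Ω) [IsProbabilityMeasure P]
    [IsProbabilityMeasure Q] :
    IsProbabilityMeasure ((2 : ℝ≥0∞)⁻¹ • P + (2 : ℝ≥0∞)⁻¹ • Q) :=
  ⟨by simp [ENNReal.inv_two_add_inv_two]⟩

lemma rnDeriv_mixture_ae_eq (P Q ν : Measure Ω) [IsFiniteMeasure P] [IsFiniteMeasure Q]
    [IsFiniteMeasure ν] :
    ∀ᵐ x ∂ν, ((((2 : ℝ≥0∞)⁻¹ • P + (2 : ℝ≥0∞)⁻¹ • Q).rnDeriv ν x).toReal) =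
      ((P.rnDeriv ν x).toReal + (Q.rnDeriv ν x).toReal) / 2 := by
  have := isFiniteMeasure_half_smul P
  have := isFiniteMeasure_half_smul Q
  have h2 : (2 : ℝ≥0∞)⁻¹ ≠ ∞ := by simp
  filter_upwards [Measure.rnDeriv_add ((2 : ℝ≥0∞)⁻¹ • P) ((2 : ℝ≥0∞)⁻¹ • Q) ν,
    Measure.rnDeriv_smul_left_of_ne_top P ν h2, Measure.rnDeriv_smul_left_of_ne_top Q ν h2,
    P.rnDeriv_lt_top ν, Q.rnDeriv_lt_top ν] with x h hP hQ hPt hQt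
  rw [h, Pi.add_apply, hP, hQ]
  simp only [Pi.smul_apply, smul_eq_mul]
  rw [ENNReal.toReal_add (ENNReal.mul_ne_top h2 hPt.ne) (ENNReal.mul_ne_top h2 hQt.ne)]
  simp
  ring

lemma KLdiv_mixture_left_eq_integral (P Q ν : Measure Ω) [IsFiniteMeasure P] [IsFiniteMeasure Q]
    [IsFiniteMeasure ν] (hP : P ≪ ν) :
    KLdiv P ((2 : ℝ≥0∞)⁻¹ • P + (2 : ℝ≥0∞)⁻¹ • Q) =
      ∫ x, (P.rnDeriv ν x).toReal * log ((P.rnDeriv ν x).toReal /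
        (((P.rnDeriv ν x).toReal + (Q.rnDeriv ν x).toReal) / 2)) ∂ν := by
  have := isFiniteMeasure_half_smul P
  have := isFiniteMeasure_half_smul Q
  rw [KLdiv, ← integral_toReal_rnDeriv_mul hP]
  refine integral_congr_ae ?_
  filter_upwards [rnDeriv_mixture_ae_eq P Q ν,
    Measure.rnDeriv_mul_rnDeriv (κ := ν) (absolutelyContinuous_mixture_left P Q)] with x hm hmul
  rcases eq_or_ne (P.rnDeriv ν x).toReal 0 with h0 | h0
  · simp [h0]
  · have hp : 0 < (P.rnDeriv ν x).toReal := lt_of_le_of_ne ENNReal.toReal_nonneg h0.symm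
    have hq : 0 ≤ (Q.rnDeriv ν x).toReal := ENNReal.toReal_nonneg
    have hmul' := congrArg ENNReal.toReal hmul
    rw [Pi.mul_apply, ENNReal.toReal_mul, hm] at hmul'
    rw [eq_div_of_mul_eq (by positivity) hmul']

lemma integrable_mul_log_div_midpoint {ν : Measure Ω} {p q : Ω → ℝ} (hp : Integrable p ν)
    (hq : Integrable q ν) (hp0 : ∀ x, 0 ≤ p x) (hq0 : ∀ x, 0 ≤ q x) :
    Integrable (fun x ↦ p x * log (p x / ((p x + q x) / 2))) ν := by
  refine (hp.add hq).mono' ?_ (ae_of_all _ fun x ↦ abs_mul_log_div_midpoint_le (hp0 x) (hq0 x))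
  have := hp.aemeasurable
  have := hq.aemeasurable
  exact AEMeasurable.aestronglyMeasurable (by fun_prop)

lemma integrable_jsFun {ν : Measure Ω} {p q : Ω → ℝ} (hp : Integrable p ν)
    (hq : Integrable q ν) (hp0 : ∀ x, 0 ≤ p x) (hq0 : ∀ x, 0 ≤ q x) :
    Integrable (fun x ↦ jsFun (p x) (q x)) ν := by
  have h1 := integrable_mul_log_div_midpoint hp hq hp0 hq0
  have h2 := integrable_mul_log_div_midpoint hq hp hq0 hp0
  simp_rw [add_comm (q _) (p _)] at h2
  exact h1.add h2

/-- The Jensen–Shannon divergence in terms of densities with respect to a dominating measure. -/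
lemma JSdiv_eq_integral_jsFun (P Q ν : Measure Ω) [IsFiniteMeasure P] [IsFiniteMeasure Q]
    [IsFiniteMeasure ν] (hP : P ≪ ν) (hQ : Q ≪ ν) :
    JSdiv P Q = (∫ x, jsFun (P.rnDeriv ν x).toReal (Q.rnDeriv ν x).toReal ∂ν) / 2 := by
  have h1 := integrable_mul_log_div_midpoint (Measure.integrable_toReal_rnDeriv (μ := P) (ν := ν))
    (Measure.integrable_toReal_rnDeriv (μ := Q) (ν := ν)) (fun _ ↦ ENNReal.toReal_nonneg)
    (fun _ ↦ ENNReal.toReal_nonneg)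
  have h2 := integrable_mul_log_div_midpoint (Measure.integrable_toReal_rnDeriv (μ := Q) (ν := ν))
    (Measure.integrable_toReal_rnDeriv (μ := P) (ν := ν)) (fun _ ↦ ENNReal.toReal_nonneg)
    (fun _ ↦ ENNReal.toReal_nonneg)
  have hKQ := KLdiv_mixture_left_eq_integral Q P ν hQ
  rw [add_comm (_ • Q)] at hKQ
  simp_rw [add_comm (Q.rnDeriv ν _).toReal] at hKQ h2
  rw [JSdiv, KLdiv_mixture_left_eq_integral P Q ν hP, hKQ, ← integral_add h1 h2]
  rfl

lemma JSdiv_nonneg (P Q : Measure Ω) [IsFiniteMeasure P] [IsFiniteMeasure Q] :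
    0 ≤ JSdiv P Q := by
  rw [JSdiv_eq_integral_jsFun P Q (P + Q) (Measure.AbsolutelyContinuous.rfl.add_right Q)
    (Measure.absolutelyContinuous_of_le (Measure.le_add_left le_rfl))]
  exact div_nonneg (integral_nonneg fun x ↦ jsFun_nonneg ENNReal.toReal_nonneg
    ENNReal.toReal_nonneg) zero_le_two

/-- The square root of the Jensen–Shannon divergence satisfies the triangle inequality. -/
lemma sqrt_JSdiv_triangle (P Q R : Measure Ω) [IsFiniteMeasure P] [IsFiniteMeasure Q]
    [IsFiniteMeasure R] : √(JSdiv P R) ≤ √(JSdiv P Q) + √(JSdiv Q R) := by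
  have hP : P ≪ P + Q + R :=
    Measure.absolutelyContinuous_of_le (by rw [add_assoc]; exact Measure.le_add_right le_rfl)
  have hQ : Q ≪ P + Q + R := Measure.absolutelyContinuous_of_le
    (Measure.le_add_right (Measure.le_add_left le_rfl))
  have hR : R ≪ P + Q + R := Measure.absolutelyContinuous_of_le (Measure.le_add_left le_rfl)
  have hnn (μ : Measure Ω) (x : Ω) : 0 ≤ (μ.rnDeriv (P + Q + R) x).toReal :=
    ENNReal.toReal_nonneg
  have hint (μ μ' : Measure Ω) [IsFiniteMeasure μ] [IsFiniteMeasure μ'] :=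
    integrable_jsFun (Measure.integrable_toReal_rnDeriv (μ := μ) (ν := P + Q + R))
      (Measure.integrable_toReal_rnDeriv (μ := μ') (ν := P + Q + R)) (hnn μ) (hnn μ')
  rw [JSdiv_eq_integral_jsFun P R _ hP hR, JSdiv_eq_integral_jsFun P Q _ hP hQ,
    JSdiv_eq_integral_jsFun Q R _ hQ hR, sqrt_div' _ zero_le_two, sqrt_div' _ zero_le_two,
    sqrt_div' _ zero_le_two, ← add_div]
  gcongr
  exact sqrt_integral_le_add (hint P R) (hint P Q) (hint Q R)
    (fun x ↦ jsFun_nonneg (hnn P x) (hnn R x)) (fun x ↦ jsFun_nonneg (hnn P x) (hnn Q x))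
    (fun x ↦ jsFun_nonneg (hnn Q x) (hnn R x))
    fun x ↦ sqrt_jsFun_triangle (hnn P x) (hnn R x) (hnn Q x)

lemma integrable_llr_mixture_left (P Q : Measure Ω) [IsFiniteMeasure P] [IsFiniteMeasure Q] :
    Integrable (llr P ((2 : ℝ≥0∞)⁻¹ • P + (2 : ℝ≥0∞)⁻¹ • Q)) P := by
  have := isFiniteMeasure_half_smul P
  have := isFiniteMeasure_half_smul Q
  set M := (2 : ℝ≥0∞)⁻¹ • P + (2 : ℝ≥0∞)⁻¹ • Q with hM
  have hPM : P ≪ M := absolutelyContinuous_mixture_left P Q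
  rw [← integrable_toReal_rnDeriv_mul_iff hPM]
  refine (integrable_mul_log_div_midpoint (Measure.integrable_toReal_rnDeriv (μ := P) (ν := M))
    (Measure.integrable_toReal_rnDeriv (μ := Q) (ν := M)) (fun _ ↦ ENNReal.toReal_nonneg)
    (fun _ ↦ ENNReal.toReal_nonneg)).congr ?_
  filter_upwards [rnDeriv_mixture_ae_eq P Q M, M.rnDeriv_self] with x hx h1
  rw [← hM, h1] at hx
  rw [← hx]
  simp [llr]

lemma KLdiv_eq_toReal_klDiv {P M : Measure Ω} [IsProbabilityMeasure P] [IsProbabilityMeasure M]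
    (h : P ≪ M) : KLdiv P M = (InformationTheory.klDiv P M).toReal := by
  rw [InformationTheory.toReal_klDiv_of_measure_eq h (by simp)]
  rfl

/-- Data-processing inequality for the Jensen–Shannon divergence. -/
lemma JSdiv_comp_le {Ω' : Type*} [MeasurableSpace Ω'] (P Q : Measure Ω) [IsProbabilityMeasure P]
    [IsProbabilityMeasure Q] (κ : Kernel Ω Ω') [IsMarkovKernel κ] :
    JSdiv (κ ∘ₘ P) (κ ∘ₘ Q) ≤ JSdiv P Q := by
  have hKL (P Q : Measure Ω) [IsProbabilityMeasure P] [IsProbabilityMeasure Q] :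
      KLdiv (κ ∘ₘ P) ((2 : ℝ≥0∞)⁻¹ • (κ ∘ₘ P) + (2 : ℝ≥0∞)⁻¹ • (κ ∘ₘ Q)) ≤
        KLdiv P ((2 : ℝ≥0∞)⁻¹ • P + (2 : ℝ≥0∞)⁻¹ • Q) := by
    have := isProbabilityMeasure_mixture P Q
    have := isProbabilityMeasure_mixture (κ ∘ₘ P) (κ ∘ₘ Q)
    rw [KLdiv_eq_toReal_klDiv (absolutelyContinuous_mixture_left _ _),
      KLdiv_eq_toReal_klDiv (absolutelyContinuous_mixture_left _ _)]
    refine ENNReal.toReal_mono (InformationTheory.klDiv_ne_top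
      (absolutelyContinuous_mixture_left _ _) (integrable_llr_mixture_left P Q)) ?_
    rw [← Measure.comp_smul, ← Measure.comp_smul, ← Measure.comp_add]
    exact InformationTheory.klDiv_comp_right_le _ _ κ
  have h1 := hKL P Q
  have h2 := hKL Q P
  rw [add_comm (_ • _), add_comm (_ • Q)] at h2
  rw [JSdiv, JSdiv]
  linarith

lemma JSdiv_map_le {Ω' : Type*} [MeasurableSpace Ω'] (P Q : Measure Ω) [IsProbabilityMeasure P]
    [IsProbabilityMeasure Q] {f : Ω → Ω'} (hf : Measurable f) :
    JSdiv (P.map f) (Q.map f) ≤ JSdiv P Q := by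
  rw [← Measure.deterministic_comp_eq_map hf, ← Measure.deterministic_comp_eq_map hf]
  exact JSdiv_comp_le P Q _

end Measure

/-- For a common first marginal, the Jensen–Shannon divergence of two joint laws is the expected
divergence of the conditional laws. -/
lemma JSdiv_compProd_right {Z Y : Type*} [MeasurableSpace Z] [MeasurableSpace Y]
    [MeasurableSpace.CountableOrCountablyGenerated Z Y] (μ : Measure Z) [IsProbabilityMeasure μ]
    (κ η : Kernel Z Y) [IsMarkovKernel κ] [IsMarkovKernel η] :
    JSdiv (μ ⊗ₘ κ) (μ ⊗ₘ η) = ∫ z, JSdiv (κ z) (η z) ∂μ := by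
  have hκ (z : Z) : κ z ≪ (κ + η) z := by
    rw [add_apply]
    exact Measure.absolutelyContinuous_of_le (Measure.le_add_right le_rfl)
  have hη (z : Z) : η z ≪ (κ + η) z := by
    rw [add_apply]
    exact Measure.absolutelyContinuous_of_le (Measure.le_add_left le_rfl)
  have hjoint (ξ : Kernel Z Y) [IsMarkovKernel ξ] (h : ∀ z, ξ z ≪ (κ + η) z) :
      (μ ⊗ₘ ξ).rnDeriv (μ ⊗ₘ (κ + η)) =ᵐ[μ ⊗ₘ (κ + η)]
        fun x ↦ ξ.rnDeriv (κ + η) x.1 x.2 := by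
    have hm : Measurable (Function.uncurry (ξ.rnDeriv (κ + η))) := Kernel.measurable_rnDeriv _ _
    have hξ : (κ + η).withDensity (ξ.rnDeriv (κ + η)) = ξ := by
      ext1 z
      exact Kernel.withDensity_rnDeriv_eq (h z)
    have : IsSFiniteKernel ((κ + η).withDensity (ξ.rnDeriv (κ + η))) := by
      rw [hξ]; infer_instance
    have heq := Measure.compProd_withDensity (μ := μ) (κ := κ + η) hm
    rw [hξ] at heq
    rw [heq]
    exact Measure.rnDeriv_withDensity _ hm
  have hac (ξ : Kernel Z Y) [IsMarkovKernel ξ] (h : ∀ z, ξ z ≪ (κ + η) z) :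
      μ ⊗ₘ ξ ≪ μ ⊗ₘ (κ + η) :=
    Measure.AbsolutelyContinuous.compProd_right (ae_of_all _ h)
  have hint := integrable_jsFun
    (Measure.integrable_toReal_rnDeriv (μ := μ ⊗ₘ κ) (ν := μ ⊗ₘ (κ + η)))
    (Measure.integrable_toReal_rnDeriv (μ := μ ⊗ₘ η) (ν := μ ⊗ₘ (κ + η)))
    (fun _ ↦ ENNReal.toReal_nonneg) (fun _ ↦ ENNReal.toReal_nonneg)
  have hae : (fun x ↦ jsFun ((μ ⊗ₘ κ).rnDeriv (μ ⊗ₘ (κ + η)) x).toReal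
        ((μ ⊗ₘ η).rnDeriv (μ ⊗ₘ (κ + η)) x).toReal) =ᵐ[μ ⊗ₘ (κ + η)]
      fun x ↦ jsFun (κ.rnDeriv (κ + η) x.1 x.2).toReal (η.rnDeriv (κ + η) x.1 x.2).toReal := by
    filter_upwards [hjoint κ hκ, hjoint η hη] with x h1 h2
    rw [h1, h2]
  rw [JSdiv_eq_integral_jsFun _ _ _ (hac κ hκ) (hac η hη), integral_congr_ae hae,
    Measure.integral_compProd (hint.congr hae), ← integral_div]
  refine integral_congr_ae (ae_of_all _ fun z ↦ ?_)
  simp only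
  rw [JSdiv_eq_integral_jsFun _ _ _ (hκ z) (hη z)]
  congr 1
  refine integral_congr_ae ?_
  filter_upwards [κ.rnDeriv_eq_rnDeriv_measure (η := κ + η) (a := z),
    η.rnDeriv_eq_rnDeriv_measure (η := κ + η) (a := z)] with y h1 h2
  rw [h1, h2]

/-- The expected conditional divergence dominates the divergence of the mixtures, and transporting
two base laws through a common kernel contracts the divergence. -/
lemma sqrt_JSdiv_comp_sub_le {Z Y : Type*} [MeasurableSpace Z] [MeasurableSpace Y]
    [MeasurableSpace.CountableOrCountablyGenerated Z Y] (μ ν : Measure Z) [IsProbabilityMeasure μ]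
    [IsProbabilityMeasure ν] (κ η : Kernel Z Y) [IsMarkovKernel κ] [IsMarkovKernel η] :
    (max (√(JSdiv (κ ∘ₘ μ) (η ∘ₘ ν)) - √(JSdiv μ ν)) 0) ^ 2 ≤ ∫ z, JSdiv (κ z) (η z) ∂μ := by
  have hmix : JSdiv (κ ∘ₘ μ) (η ∘ₘ μ) ≤ ∫ z, JSdiv (κ z) (η z) ∂μ := by
    rw [← JSdiv_compProd_right, ← Measure.snd_compProd, ← Measure.snd_compProd]
    exact JSdiv_map_le _ _ measurable_snd
  have htri := sqrt_JSdiv_triangle (κ ∘ₘ μ) (η ∘ₘ μ) (η ∘ₘ ν)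
  have hmix' := sqrt_le_sqrt hmix
  have hbase := sqrt_le_sqrt (JSdiv_comp_le μ ν η)
  have h0 : 0 ≤ ∫ z, JSdiv (κ z) (η z) ∂μ := (JSdiv_nonneg _ _).trans hmix
  rw [← sq_sqrt h0]
  exact pow_le_pow_left₀ (le_max_right _ _) (max_le (by linarith) (sqrt_nonneg _)) 2

/-- lower bound on the label conditional shift. For joints
`Ŝ = Ŝ(z) ⊗ Ŝ(y|z)` and `T̂ = T̂(z) ⊗ T̂(y|z)` over countable `Z × Y`, the sum of the
expected conditional JS divergences (under both feature marginals) is at least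
`2 (max(√D_JS(T̂(y)‖Ŝ(y)) - √D_JS(Ŝ(z)‖T̂(z)), 0))²`. -/
theorem label_conditional_shift_lower_bound {Z Y : Type*}
    [MeasurableSpace Z] [Countable Z] [MeasurableSpace Y] [Countable Y]
    (μS μT : Measure Z) [IsProbabilityMeasure μS] [IsProbabilityMeasure μT]
    (κS κT : Kernel Z Y) [IsMarkovKernel κS] [IsMarkovKernel κT]
    (S T : Measure (Z × Y)) (hS : S = μS ⊗ₘ κS) (hT : T = μT ⊗ₘ κT) :
    (∫ z, JSdiv (κS z) (κT z) ∂μT) + ∫ z, JSdiv (κS z) (κT z) ∂μS ≥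
      2 * (max (Real.sqrt (JSdiv (T.map Prod.snd) (S.map Prod.snd)) -
        Real.sqrt (JSdiv μS μT)) 0) ^ 2 := by
  have hTS := sqrt_JSdiv_comp_sub_le μT μS κT κS
  have hST := sqrt_JSdiv_comp_sub_le μS μT κS κT
  have hsnd (μ : Measure Z) [IsProbabilityMeasure μ] (κ : Kernel Z Y) [IsMarkovKernel κ] :
      (μ ⊗ₘ κ).map Prod.snd = κ ∘ₘ μ := Measure.snd_compProd μ κ
  simp_rw [JSdiv_comm (κT _) (κS _)] at hTS
  rw [JSdiv_comm μT μS] at hTS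
  rw [JSdiv_comm (κS ∘ₘ μS)] at hST
  rw [hS, hT, hsnd, hsnd]
  linarith
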